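/- Let L and H be finite-dimensional p-nilpotent restricted Lie algebras over a perfect field F of characteristic p > 0, let φ : u(L) → u(H) be an algebra isomorphism with φ(ω(L)) = ω(H), and let E ⊆ u(L) be as in the context. Then H ∩ φ(E) ⊆ J_H. -/

import Mathlib

open UniversalEnvelopingAlgebra

attribute [local instance 100] LieRing.ofAssociativeRing

/-- A restricted Lie algebra over a field `F` of characteristic `p`: a Lie algebra equipped
with a `p`-map `x ↦ x^[p]` satisfying Jacobson's identities.  The additive identity
`(x+y)^[p] = x^[p] + y^[p] + Σ sᵢ(x,y)` (with `sᵢ` the Jacobson polynomials) is expressed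
faithfully inside the universal enveloping algebra, where it reads
`ι((x+y)^[p]) - ι(x^[p]) - ι(y^[p]) = (ι x + ι y)^p - (ι x)^p - (ι y)^p`. -/
class RestrictedLieAlgebra (p : ℕ) (F : Type*) (L : Type*) [Field F]
    [LieRing L] [LieAlgebra F L] : Type _ where
  pOp : L → L
  pOp_smul : ∀ (a : F) (x : L), pOp (a • x) = a ^ p • pOp x
  ad_pOp : ∀ x y : L, ⁅pOp x, y⁆ = ((LieAlgebra.ad F L x) ^ p) y
  pOp_add : ∀ x y : L,
    ι F (pOp (x + y)) - ι F (pOp x) - ι F (pOp y)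
      = (ι F x + ι F y) ^ p - (ι F x) ^ p - (ι F y) ^ p

namespace RestrictedLieAlgebra

variable (p : ℕ) (F : Type*) [Field F]

section Defs

variable (L : Type*) [LieRing L] [LieAlgebra F L] [RestrictedLieAlgebra p F L]

/-- The `p`-map of a restricted Lie algebra. -/
abbrev pmap (x : L) : L := RestrictedLieAlgebra.pOp (p := p) (F := F) x

/-- The relation defining the restricted enveloping algebra as a quotient of the
universal enveloping algebra: `x^p = x^[p]` for all `x ∈ L`. -/
def uRel : UniversalEnvelopingAlgebra F L → UniversalEnvelopingAlgebra F L → Prop :=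
  fun a b => ∃ x : L, a = (ι F x) ^ p ∧ b = ι F (pmap p F L x)

/-- The restricted enveloping algebra `u(L)`: the quotient of the universal enveloping
algebra of `L` by the two-sided ideal generated by `{x^p - x^[p] : x ∈ L}`. -/
abbrev uEnv := RingQuot (uRel p F L)

/-- The canonical (linear) embedding `L → u(L)`. -/
def uemb : L →ₗ[F] uEnv p F L :=
  ((RingQuot.mkAlgHom F (uRel p F L)).toLinearMap).comp (ι F : L →ₗ⁅F⁆ _).toLinearMap

variable [Fact p.Prime]

/-- The augmentation map `ε : u(L) → F`, induced by `x ↦ 0` for `x ∈ L`. -/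
noncomputable def aug : uEnv p F L →ₐ[F] F :=
  RingQuot.liftAlgHom F
    ⟨(UniversalEnvelopingAlgebra.lift F) (0 : L →ₗ⁅F⁆ F), by
      rintro a b ⟨x, rfl, rfl⟩
      simp [UniversalEnvelopingAlgebra.lift_ι_apply,
        zero_pow (Nat.Prime.ne_zero (Fact.out : p.Prime))]⟩

/-- The augmentation ideal `ω(L)`, i.e. the kernel of the augmentation map, as a
subspace of `u(L)`. -/
noncomputable def omegaIdeal : Submodule F (uEnv p F L) :=
  LinearMap.ker (aug p F L).toLinearMap

/-- The image of `L` inside `u(L)`. -/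
def lSub : Submodule F (uEnv p F L) := LinearMap.range (uemb p F L)

end Defs

section Closure

variable {L : Type*} [LieRing L] [LieAlgebra F L] [RestrictedLieAlgebra p F L]

/-- The restricted subalgebra generated by a subset `S` of `L`: the smallest Lie
subalgebra containing `S` which is closed under the `p`-map. -/
def restrictedClosure (S : Set L) : LieSubalgebra F L :=
  sInf {K : LieSubalgebra F L | S ⊆ K ∧ ∀ x ∈ K, pmap p F L x ∈ K}

/-- For a subalgebra `N ⊆ L`, the restricted subalgebra `N^p` generated by all
`x^[p]`, `x ∈ N`. -/
def subPPow (K : LieSubalgebra F L) : LieSubalgebra F L :=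
  restrictedClosure p F (pmap p F L '' K)

end Closure

section PNilpotent

variable (L : Type*) [LieRing L] [LieAlgebra F L] [RestrictedLieAlgebra p F L]

/-- `L` is `p`-nilpotent if `L^{pˢ} = 0` for some `s`, where `L^p` denotes the restricted
subalgebra generated by all `x^[p]`. -/
def IsPNilpotent : Prop :=
  ∃ s : ℕ, (subPPow p F)^[s] (⊤ : LieSubalgebra F L) = ⊥

/-- The derived subalgebra `L' = γ₂(L)` as a submodule of `L`. -/
abbrev derivedSub : Submodule F L := (LieModule.lowerCentralSeries F L L 1).toSubmodule

/-- `L'_p`, the restricted subalgebra generated by `L'`, as a submodule. -/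
def derivedP : Submodule F L :=
  (restrictedClosure p F (derivedSub F L : Set L)).toSubmodule

/-- `L'^p + γ₃(L)`, as a submodule of `L`. -/
def mainIdeal : Submodule F L :=
  (subPPow p F (restrictedClosure p F (derivedSub F L : Set L))).toSubmodule
    ⊔ (LieModule.lowerCentralSeries F L L 2).toSubmodule

end PNilpotent

end RestrictedLieAlgebra

namespace RestrictedLieAlgebra

section Setup

variable (p : ℕ) (F : Type*) [Field F] [Fact p.Prime]
variable (L : Type*) [LieRing L] [LieAlgebra F L] [RestrictedLieAlgebra p F L]

/-- The ideal `J_L = ω(L)L' + L'ω(L)` of `u(L)`, as a subspace. -/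
noncomputable def jIdeal : Submodule F (uEnv p F L) :=
  omegaIdeal p F L * ((derivedSub F L).map (uemb p F L))
    + ((derivedSub F L).map (uemb p F L)) * omegaIdeal p F L

/-- The subspace `E` of `u(L)`: the span of `J_L` together with all PBW monomials of
degree at least two in the fixed set `X` of representatives. -/
noncomputable def eSpace (n : ℕ) (ex : Fin n → ℕ) (X : (i : Fin n) → Fin (ex i) → L) :
    Submodule F (uEnv p F L) :=
  jIdeal p F L ⊔
    Submodule.span F
      {u : uEnv p F L | ∃ a : (i : Fin n) → Fin (ex i) → ℕ,
        (∀ i j, a i j < p) ∧ 2 ≤ ∑ i, ∑ j, a i j ∧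
        u = ((List.finRange n).map (fun i =>
              ((List.finRange (ex i)).map
                (fun j => uemb p F L (X i j) ^ a i j)).prod)).prod}

/-- The data `e₁, …, e_n ∈ L` together with exponents `ex i = exp(ēᵢ)` and a set `X` of
coset representatives, expressing the decomposition
`L/L'_p = ⟨ē₁⟩_p ⊕ ⋯ ⊕ ⟨ē_n⟩_p` via the resulting basis `ēᵢ^{[p]^j}` (`0 ≤ j < ex i`)
of `L/L'_p`. -/
def GoodPresentation (n : ℕ) (e : Fin n → L) (ex : Fin n → ℕ)
    (X : (i : Fin n) → Fin (ex i) → L) : Prop :=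
  LinearIndependent F
    (fun q : Σ i : Fin n, Fin (ex i) =>
      (Submodule.Quotient.mk ((pmap p F L)^[(q.2 : ℕ)] (e q.1)) : L ⧸ derivedP p F L)) ∧
  Submodule.span F
    (Set.range (fun q : Σ i : Fin n, Fin (ex i) =>
      (Submodule.Quotient.mk ((pmap p F L)^[(q.2 : ℕ)] (e q.1)) : L ⧸ derivedP p F L))) = ⊤ ∧
  (∀ i, (pmap p F L)^[ex i] (e i) ∈ derivedP p F L) ∧
  (∀ i (j : Fin (ex i)), X i j - (pmap p F L)^[(j : ℕ)] (e i) ∈ derivedP p F L)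

end Setup

end RestrictedLieAlgebra

namespace RestrictedLieAlgebra

section TopMul

variable {F A : Type*} [CommSemiring F] [Semiring A] [Algebra F A] {M : Submodule F A}

lemma mul_mem_top_mul (c : A) {t : A} (ht : t ∈ ⊤ * M) : c * t ∈ ⊤ * M := by
  have h := Submodule.mul_mem_mul (Submodule.mem_top (x := c)) ht
  rw [← mul_assoc] at h
  exact mul_le_mul_left le_top M h

lemma mul_mem_mul_top (c : A) {t : A} (ht : t ∈ M * ⊤) : t * c ∈ M * ⊤ := by
  have h := Submodule.mul_mem_mul ht (Submodule.mem_top (x := c))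
  rw [mul_assoc] at h
  exact mul_le_mul_right le_top M h

end TopMul

section Enveloping

variable (p : ℕ) (F : Type*) [Field F]
variable (L : Type*) [LieRing L] [LieAlgebra F L] [RestrictedLieAlgebra p F L]

lemma derivedSub_eq_span :
    derivedSub F L = Submodule.span F {z : L | ∃ x y : L, ⁅x, y⁆ = z} := by
  have h : LieModule.lowerCentralSeries F L L 1 = ⁅(⊤ : LieIdeal F L), (⊤ : LieIdeal F L)⁆ := by
    rw [LieModule.lowerCentralSeries_succ, LieModule.lowerCentralSeries_zero]
  rw [derivedSub, h, LieSubmodule.lieIdeal_oper_eq_linear_span']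
  simp

variable {L}

lemma lie_mem_derivedSub (x y : L) : ⁅x, y⁆ ∈ derivedSub F L := by
  rw [derivedSub_eq_span]
  exact Submodule.subset_span ⟨x, y, rfl⟩

lemma mem_restrictedClosure {S : Set L} {x : L} :
    x ∈ restrictedClosure p F S ↔
      ∀ K : LieSubalgebra F L, S ⊆ K → (∀ x ∈ K, pmap p F L x ∈ K) → x ∈ K := by
  rw [restrictedClosure, ← SetLike.mem_coe, LieSubalgebra.coe_sInf]
  simp

lemma derivedSub_le_derivedP : derivedSub F L ≤ derivedP p F L := by
  intro x hx
  rw [derivedP, LieSubalgebra.mem_toSubmodule, mem_restrictedClosure]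
  exact fun K hK _ => hK hx

lemma pmap_mem_derivedP {x : L} (hx : x ∈ derivedP p F L) : pmap p F L x ∈ derivedP p F L := by
  rw [derivedP, LieSubalgebra.mem_toSubmodule, mem_restrictedClosure] at hx ⊢
  exact fun K hK hp => hp x (hx K hK hp)

variable {p F}

lemma uemb_pmap (x : L) : uemb p F L (pmap p F L x) = uemb p F L x ^ p := by
  have h : uRel p F L ((ι F x) ^ p) (ι F (pmap p F L x)) := ⟨x, rfl, rfl⟩
  simpa [uemb] using (RingQuot.mkAlgHom_rel F h).symm

lemma uemb_iterate_pmap (x : L) (k : ℕ) :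
    uemb p F L ((pmap p F L)^[k] x) = uemb p F L x ^ p ^ k := by
  induction k with
  | zero => simp
  | succ k ih => rw [Function.iterate_succ_apply', uemb_pmap, ih, ← pow_mul, pow_succ]

lemma uemb_lie (x y : L) :
    uemb p F L ⁅x, y⁆ = uemb p F L x * uemb p F L y - uemb p F L y * uemb p F L x := by
  simp [uemb, LieRing.of_associative_ring_bracket]

variable (p F L) in
lemma adjoin_range_uemb : Algebra.adjoin F (Set.range (uemb p F L)) = ⊤ := by
  have h := congrArg (Subalgebra.map
    ((RingQuot.mkAlgHom F (uRel p F L)).comp (UniversalEnvelopingAlgebra.mkAlgHom F L)))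
    (TensorAlgebra.adjoin_range_ι (R := F) (M := L))
  rw [AlgHom.map_adjoin, Algebra.map_top, (AlgHom.range_eq_top _).2, ← Set.range_comp] at h
  · exact h
  · rw [AlgHom.coe_comp]
    exact (RingQuot.mkAlgHom_surjective F _).comp
      (RingCon.mk'_surjective _)

/-- Induction principle for the restricted enveloping algebra. -/
lemma uEnv_induction {C : uEnv p F L → Prop} (hL : ∀ x, C (uemb p F L x))
    (hF : ∀ r : F, C (algebraMap F _ r)) (hadd : ∀ a b, C a → C b → C (a + b))
    (hmul : ∀ a b, C a → C b → C (a * b)) (a : uEnv p F L) : C a := by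
  have ha : a ∈ Algebra.adjoin F (Set.range (uemb p F L)) := by
    rw [adjoin_range_uemb]; trivial
  induction ha using Algebra.adjoin_induction with
  | mem x hx => obtain ⟨y, rfl⟩ := hx; exact hL y
  | algebraMap r => exact hF r
  | add a b _ _ ha hb => exact hadd a b ha hb
  | mul a b _ _ ha hb => exact hmul a b ha hb

variable {B : Type*} [CommRing B] [Algebra F B]

/-- An algebra map from `u(L)` to a commutative algebra vanishes on `L'_p`. -/
lemma map_uemb_eq_zero [Fact p.Prime] (g : uEnv p F L →ₐ[F] B) {x : L}
    (hx : x ∈ derivedP p F L) : g (uemb p F L x) = 0 := by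
  let K : LieSubalgebra F L :=
    { LinearMap.ker (g.toLinearMap.comp (uemb p F L)) with
      lie_mem' := fun {x y} _ _ => by
        change g (uemb p F L ⁅x, y⁆) = 0
        rw [uemb_lie, map_sub, map_mul, map_mul, mul_comm, sub_self] }
  have hK : ∀ y, y ∈ K ↔ g (uemb p F L y) = 0 := fun y => Iff.rfl
  rw [derivedP, LieSubalgebra.mem_toSubmodule, mem_restrictedClosure] at hx
  refine (hK x).1 (hx K ?_ ?_)
  · have : derivedSub F L ≤ K.toSubmodule := by
      rw [derivedSub_eq_span, Submodule.span_le]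
      rintro _ ⟨x, y, rfl⟩
      change g (uemb p F L ⁅x, y⁆) = 0
      rw [uemb_lie, map_sub, map_mul, map_mul, mul_comm, sub_self]
    exact this
  · intro y hy
    rw [hK] at hy ⊢
    rw [uemb_pmap, map_pow, hy, zero_pow (Fact.out : p.Prime).ne_zero]

/-- The universal property of `u(L)` for maps to commutative algebras. -/
lemma exists_algHom_of_comm (f : L →ₗ[F] B) (hf : ∀ x ∈ derivedSub F L, f x = 0)
    (hp : ∀ x, f (pmap p F L x) = f x ^ p) :
    ∃ g : uEnv p F L →ₐ[F] B, ∀ x, g (uemb p F L x) = f x := by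
  let f' : L →ₗ⁅F⁆ B :=
    { f with
      map_lie' := fun {x y} => by
        change f ⁅x, y⁆ = f x * f y - f y * f x
        rw [hf _ (lie_mem_derivedSub F x y), mul_comm, sub_self] }
  refine ⟨RingQuot.liftAlgHom F ⟨UniversalEnvelopingAlgebra.lift F f', ?_⟩, fun x => ?_⟩
  · rintro _ _ ⟨x, rfl, rfl⟩
    rw [map_pow, UniversalEnvelopingAlgebra.lift_ι_apply, UniversalEnvelopingAlgebra.lift_ι_apply]
    exact (hp x).symm
  · simp only [uemb, LinearMap.comp_apply]
    exact (RingQuot.liftAlgHom_mkAlgHom_apply F _ _ _).trans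
      (UniversalEnvelopingAlgebra.lift_ι_apply F f' x)

/-- The `p`-map is additive modulo `L'`. -/
lemma pmap_add_sub_mem_derivedSub [Fact p.Prime] [CharP F p] (x y : L) :
    pmap p F L (x + y) - pmap p F L x - pmap p F L y ∈ derivedSub F L := by
  by_contra hz
  obtain ⟨f, hfz, hf⟩ := Submodule.exists_le_ker_of_notMem hz
  let q : L →ₗ[F] DualNumber F := (TrivSqZeroExt.inrHom F F).comp f
  let f' : L →ₗ⁅F⁆ DualNumber F :=
    { q with
      map_lie' := fun {x y} => by
        change q ⁅x, y⁆ = q x * q y - q y * q x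
        rw [mul_comm, sub_self]
        have : f ⁅x, y⁆ = 0 := hf (lie_mem_derivedSub F x y)
        simp [q, this] }
  have : CharP (DualNumber F) p :=
    charP_of_injective_algebraMap (algebraMap F (DualNumber F)).injective p
  have h := congrArg (UniversalEnvelopingAlgebra.lift F f') (pOp_add (p := p) (F := F) x y)
  simp only [map_sub, map_pow, map_add, UniversalEnvelopingAlgebra.lift_ι_apply,
    add_pow_char] at h
  rw [add_sub_cancel_left, sub_self, ← map_sub, ← map_sub] at h
  have h2 : TrivSqZeroExt.inr (f (pmap p F L (x + y) - pmap p F L x - pmap p F L y))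
      = (0 : DualNumber F) := h
  rw [← TrivSqZeroExt.inr_zero, TrivSqZeroExt.inr_injective.eq_iff] at h2
  exact hfz h2

lemma exists_iterate_pmap_eq_zero (hL : IsPNilpotent p F L) :
    ∃ s, ∀ x : L, (pmap p F L)^[s] x = 0 := by
  obtain ⟨s, hs⟩ := hL
  have key : ∀ k (x : L), (pmap p F L)^[k] x ∈ (subPPow p F)^[k] (⊤ : LieSubalgebra F L) := by
    intro k
    induction k with
    | zero => intro x; simp
    | succ k ih =>
      intro x
      rw [Function.iterate_succ_apply', Function.iterate_succ_apply']
      exact (mem_restrictedClosure p F).2 fun K hK _ => hK ⟨_, ih x, rfl⟩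
  refine ⟨s, fun x => ?_⟩
  have := key s x
  rwa [hs, LieSubalgebra.mem_bot] at this

end Enveloping

section Ideal

variable (p : ℕ) (F : Type*) [Field F]
variable (L : Type*) [LieRing L] [LieAlgebra F L] [RestrictedLieAlgebra p F L]

/-- The image of `L'` in `u(L)`. -/
abbrev uDerived : Submodule F (uEnv p F L) := (derivedSub F L).map (uemb p F L)

variable {p F L}

lemma uemb_commutator_mem (x : L) {l : uEnv p F L} (hl : l ∈ uDerived p F L) :
    uemb p F L x * l - l * uemb p F L x ∈ uDerived p F L := by
  obtain ⟨y, -, rfl⟩ := hl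
  rw [← uemb_lie]
  exact Submodule.mem_map_of_mem (lie_mem_derivedSub F x y)

variable (p F L) in
lemma uDerived_mul_top_le : uDerived p F L * ⊤ ≤ ⊤ * uDerived p F L := by
  have hle : uDerived p F L ≤ ⊤ * uDerived p F L := fun l hl => by
    simpa using Submodule.mul_mem_mul (Submodule.mem_top (x := (1 : uEnv p F L))) hl
  suffices h : ∀ a, ∀ l ∈ uDerived p F L, l * a ∈ ⊤ * uDerived p F L from
    Submodule.mul_le.2 fun l hl a _ => h a l hl
  intro a
  induction a using uEnv_induction with
  | hL x =>
    intro l hl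
    have h := Submodule.sub_mem _ (mul_mem_top_mul (uemb p F L x) (hle hl))
      (hle (uemb_commutator_mem x hl))
    rwa [sub_sub_cancel] at h
  | hF r =>
    intro l hl
    rw [← Algebra.commutes]
    exact mul_mem_top_mul _ (hle hl)
  | hadd a b ha hb =>
    intro l hl
    rw [mul_add]
    exact Submodule.add_mem _ (ha l hl) (hb l hl)
  | hmul a b ha hb =>
    intro l hl
    rw [← mul_assoc]
    refine Submodule.mul_induction_on (ha l hl) (fun c _ m hm => ?_) fun s t hs ht => ?_
    · rw [mul_assoc]
      exact mul_mem_top_mul _ (hb m hm)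
    · rw [add_mul]
      exact Submodule.add_mem _ hs ht

variable (p F L) in
lemma top_mul_uDerived_le : ⊤ * uDerived p F L ≤ uDerived p F L * ⊤ := by
  have hle : uDerived p F L ≤ uDerived p F L * ⊤ := fun l hl => by
    simpa using Submodule.mul_mem_mul hl (Submodule.mem_top (x := (1 : uEnv p F L)))
  suffices h : ∀ a, ∀ l ∈ uDerived p F L, a * l ∈ uDerived p F L * ⊤ from
    Submodule.mul_le.2 fun a _ l hl => h a l hl
  intro a
  induction a using uEnv_induction with
  | hL x =>
    intro l hl
    have h := Submodule.add_mem _ (hle (uemb_commutator_mem x hl))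
      (mul_mem_mul_top (uemb p F L x) (hle hl))
    rwa [sub_add_cancel] at h
  | hF r =>
    intro l hl
    rw [Algebra.commutes]
    exact mul_mem_mul_top _ (hle hl)
  | hadd a b ha hb =>
    intro l hl
    rw [add_mul]
    exact Submodule.add_mem _ (ha l hl) (hb l hl)
  | hmul a b ha hb =>
    intro l hl
    rw [mul_assoc]
    refine Submodule.mul_induction_on (hb l hl) (fun m hm c _ => ?_) fun s t hs ht => ?_
    · rw [← mul_assoc]
      exact mul_mem_mul_top _ (ha m hm)
    · rw [mul_add]
      exact Submodule.add_mem _ hs ht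

/-- All commutators of `u(L)` lie in `u(L)L'`. -/
lemma commutator_mem (a b : uEnv p F L) : a * b - b * a ∈ ⊤ * uDerived p F L := by
  have hright : ∀ c, ∀ t ∈ (⊤ : Submodule F (uEnv p F L)) * uDerived p F L,
      t * c ∈ (⊤ : Submodule F (uEnv p F L)) * uDerived p F L := fun c t ht =>
    uDerived_mul_top_le p F L (mul_mem_mul_top c (top_mul_uDerived_le p F L ht))
  have hx : ∀ (x : L) (b : uEnv p F L),
      uemb p F L x * b - b * uemb p F L x ∈ ⊤ * uDerived p F L := by
    intro x b
    induction b using uEnv_induction with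
    | hL y =>
      rw [← uemb_lie]
      simpa using Submodule.mul_mem_mul (Submodule.mem_top (x := (1 : uEnv p F L)))
        (Submodule.mem_map_of_mem (f := uemb p F L) (lie_mem_derivedSub F x y))
    | hF r => rw [Algebra.commutes, sub_self]; exact Submodule.zero_mem _
    | hadd b c hb hc =>
      convert Submodule.add_mem _ hb hc using 1
      noncomm_ring
    | hmul b c hb hc =>
      convert Submodule.add_mem _ (hright c _ hb) (mul_mem_top_mul b hc) using 1
      noncomm_ring
  induction a using uEnv_induction with
  | hL x => exact hx x b
  | hF r => rw [Algebra.commutes, sub_self]; exact Submodule.zero_mem _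
  | hadd a c ha hc =>
    convert Submodule.add_mem _ ha hc using 1
    noncomm_ring
  | hmul a c ha hc =>
    convert Submodule.add_mem _ (mul_mem_top_mul a hc) (hright c _ ha) using 1
    noncomm_ring

variable {H : Type*} [LieRing H] [LieAlgebra F H] [RestrictedLieAlgebra p F H]

/-- An augmentation-preserving isomorphism maps `J_L` into `J_H`. -/
lemma map_jIdeal_le [Fact p.Prime] (φ : uEnv p F L ≃ₐ[F] uEnv p F H)
    (hω : (omegaIdeal p F L).map φ.toLinearMap = omegaIdeal p F H) :
    (jIdeal p F L).map φ.toLinearMap ≤ jIdeal p F H := by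
  have hω' : (omegaIdeal p F L).map (φ : uEnv p F L →ₐ[F] uEnv p F H).toLinearMap
      = omegaIdeal p F H := hω
  have hD : (uDerived p F L).map (φ : uEnv p F L →ₐ[F] uEnv p F H).toLinearMap
      ≤ ⊤ * uDerived p F H := by
    rw [uDerived, derivedSub_eq_span, Submodule.map_span, Submodule.map_span, Submodule.span_le]
    rintro _ ⟨_, ⟨_, ⟨x, y, rfl⟩, rfl⟩, rfl⟩
    rw [uemb_lie]
    simpa using commutator_mem (φ (uemb p F L x)) (φ (uemb p F L y))
  have hωtop : omegaIdeal p F H * ⊤ ≤ omegaIdeal p F H := Submodule.mul_le.2 fun a ha b _ => by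
    have ha' : aug p F H a = 0 := ha
    change aug p F H (a * b) = 0
    rw [map_mul, ha', zero_mul]
  have htopω : ⊤ * omegaIdeal p F H ≤ omegaIdeal p F H := Submodule.mul_le.2 fun a _ b hb => by
    have hb' : aug p F H b = 0 := hb
    change aug p F H (a * b) = 0
    rw [map_mul, hb', mul_zero]
  change (jIdeal p F L).map (φ : uEnv p F L →ₐ[F] uEnv p F H).toLinearMap ≤ _
  simp only [jIdeal, Submodule.add_eq_sup, Submodule.map_sup, Submodule.map_mul, hω']
  refine sup_le_sup ?_ ?_
  · calc _ ≤ omegaIdeal p F H * (⊤ * uDerived p F H) := mul_le_mul_right hD _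
      _ = omegaIdeal p F H * ⊤ * uDerived p F H := (mul_assoc _ _ _).symm
      _ ≤ _ := mul_le_mul_left hωtop _
  · calc _ ≤ (uDerived p F H * ⊤) * omegaIdeal p F H :=
          mul_le_mul_left (hD.trans (top_mul_uDerived_le p F H)) _
      _ = uDerived p F H * (⊤ * omegaIdeal p F H) := mul_assoc _ _ _
      _ ≤ _ := mul_le_mul_right htopω _

/-- `J_L` vanishes in every commutative quotient of `u(L)`. -/
lemma map_eq_zero_of_mem_jIdeal [Fact p.Prime] {B : Type*} [CommRing B] [Algebra F B]
    (g : uEnv p F L →ₐ[F] B) {a : uEnv p F L} (ha : a ∈ jIdeal p F L) : g a = 0 := by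
  have hD : ∀ l ∈ uDerived p F L, g l = 0 := by
    rintro _ ⟨x, hx, rfl⟩
    exact map_uemb_eq_zero g (derivedSub_le_derivedP p F hx)
  have : jIdeal p F L ≤ LinearMap.ker g.toLinearMap := by
    refine sup_le (Submodule.mul_le.2 fun a _ l hl => ?_) (Submodule.mul_le.2 fun l hl a _ => ?_)
    · simp [hD l hl]
    · simp [hD l hl]
  exact this ha

end Ideal

section Tower

universe uF uL

variable {p : ℕ} [Fact p.Prime] {F : Type uF} [Field F]
variable {L : Type uL} [LieRing L] [LieAlgebra F L] [RestrictedLieAlgebra p F L]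

/-- `f : L → R` restricts to a map on the subspace `W ⊇ L'_p` that presents `R` as the restricted
enveloping algebra of the abelian restricted Lie algebra `W / L'_p`, as far as generation and
dimension are concerned. -/
structure IsAbelianEnvelope (p : ℕ) [RestrictedLieAlgebra p F L] (W : Submodule F L)
    {R : Type*} [CommRing R] [Algebra F R] (f : L →ₗ[F] R) : Prop where
  derivedP_le : derivedP p F L ≤ W
  map_derivedP : ∀ x ∈ derivedP p F L, f x = 0
  pmap_mem : ∀ x ∈ W, pmap p F L x ∈ W
  map_pmap : ∀ x ∈ W, f (pmap p F L x) = f x ^ p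
  adjoin_eq : Algebra.adjoin F (f '' W) = ⊤
  finite : Module.Finite F R
  nontrivial : Nontrivial R
  finrank_mul : Module.finrank F R * p ^ Module.finrank F (derivedP p F L)
    = p ^ Module.finrank F W

lemma isAbelianEnvelope_derivedP : IsAbelianEnvelope p (derivedP p F L) (0 : L →ₗ[F] F) where
  derivedP_le := le_rfl
  map_derivedP _ _ := rfl
  pmap_mem _ := pmap_mem_derivedP p F
  map_pmap _ _ := by simp [zero_pow (Fact.out : p.Prime).ne_zero]
  adjoin_eq := Subsingleton.elim _ _
  finite := inferInstance
  nontrivial := inferInstance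
  finrank_mul := by simp

open Polynomial in
/-- Adjoining a `p`-th root enlarges the domain of an abelian envelope by one dimension. -/
lemma IsAbelianEnvelope.exists_succ [CharP F p] [FiniteDimensional F L] {W : Submodule F L}
    {R : Type uF} [CommRing R] [Algebra F R] {f : L →ₗ[F] R} (hf : IsAbelianEnvelope p W f)
    {b : L} (hb : b ∉ W) (hbp : pmap p F L b ∈ W) :
    ∃ (R' : Type uF) (_ : CommRing R') (_ : Algebra F R') (f₁ : L →ₗ[F] R'),
      IsAbelianEnvelope p (W ⊔ Submodule.span F {b}) f₁ := by
  have hp : p.Prime := Fact.out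
  have := hf.nontrivial
  have := hf.finite
  obtain ⟨l₀, hl₀, hlW₀⟩ := Submodule.exists_le_ker_of_notMem hb
  obtain ⟨l, hlb, hlW⟩ : ∃ l : L →ₗ[F] F, l b = 1 ∧ ∀ w ∈ W, l w = 0 :=
    ⟨(l₀ b)⁻¹ • l₀, by simp [hl₀], fun w hw => by
      have : l₀ w = 0 := hlW₀ hw
      simp [this]⟩
  let g : R[X] := X ^ p - C (f (pmap p F L b))
  have hg : g.Monic := monic_X_pow_sub_C _ hp.ne_zero
  have hdeg : g.natDegree = p := natDegree_X_pow_sub_C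
  let R' := AdjoinRoot g
  let rt : R' := AdjoinRoot.root g
  have hrt : rt ^ p = algebraMap R R' (f (pmap p F L b)) := by
    have h := AdjoinRoot.eval₂_root g
    simp only [g, eval₂_sub, eval₂_X_pow, eval₂_C] at h
    exact sub_eq_zero.1 h
  have : Module.Free R R' := .of_basis (AdjoinRoot.powerBasis' hg).basis
  have : Module.Finite R R' := (AdjoinRoot.powerBasis' hg).finite
  have hfin : Module.finrank R R' = p := by
    rw [(AdjoinRoot.powerBasis' hg).finrank, AdjoinRoot.powerBasis'_dim, hdeg]
  have : Nontrivial R' := Module.nontrivial_of_finrank_pos (R := R) (by rw [hfin]; exact hp.pos)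
  have : CharP R' p := charP_of_injective_algebraMap (algebraMap F R').injective p
  let alg : R →ₐ[F] R' := IsScalarTower.toAlgHom F R R'
  let f₁ : L →ₗ[F] R' :=
    alg.toLinearMap.comp (f.comp (LinearMap.id - l.smulRight b)) + l.smulRight rt
  have hf₁W : ∀ w ∈ W, f₁ w = alg (f w) := fun w hw => by simp [f₁, hlW w hw]
  have hf₁b : f₁ b = rt := by simp [f₁, hlb]
  have hadd : ∀ x y : L, ∃ z ∈ derivedP p F L,
      pmap p F L (x + y) = pmap p F L x + pmap p F L y + z := fun x y =>
    ⟨_, derivedSub_le_derivedP p F (pmap_add_sub_mem_derivedSub (p := p) x y), by abel⟩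
  have hdecomp : ∀ x ∈ W ⊔ Submodule.span F {b}, ∃ w ∈ W, ∃ a : F, x = w + a • b := by
    intro x hx
    obtain ⟨w, hw, y, hy, rfl⟩ := Submodule.mem_sup.1 hx
    obtain ⟨a, rfl⟩ := Submodule.mem_span_singleton.1 hy
    exact ⟨w, hw, a, rfl⟩
  have hsmul : ∀ a : F, pmap p F L (a • b) = a ^ p • pmap p F L b := fun a => pOp_smul a b
  have hpW : ∀ w ∈ W, ∀ a : F, ∃ z ∈ derivedP p F L,
      pmap p F L (w + a • b) = pmap p F L w + a ^ p • pmap p F L b + z := fun w _ a => by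
    obtain ⟨z, hz, h⟩ := hadd w (a • b)
    exact ⟨z, hz, by rw [h, hsmul]⟩
  have hmemW : ∀ w ∈ W, ∀ a : F, pmap p F L (w + a • b) ∈ W := fun w hw a => by
    obtain ⟨z, hz, h⟩ := hpW w hw a
    rw [h]
    exact W.add_mem (W.add_mem (hf.pmap_mem w hw) (W.smul_mem _ hbp)) (hf.derivedP_le hz)
  refine ⟨R', inferInstance, inferInstance, f₁, ?_, ?_, ?_, ?_, ?_, ?_, inferInstance, ?_⟩
  · exact hf.derivedP_le.trans le_sup_left
  · intro x hx
    rw [hf₁W x (hf.derivedP_le hx), hf.map_derivedP x hx, map_zero]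
  · intro x hx
    obtain ⟨w, hw, a, rfl⟩ := hdecomp x hx
    exact le_sup_left (a := W) (hmemW w hw a)
  · intro x hx
    obtain ⟨w, hw, a, rfl⟩ := hdecomp x hx
    rw [hf₁W _ (hmemW w hw a)]
    obtain ⟨z, hz, h⟩ := hpW w hw a
    have hfx : f (pmap p F L (w + a • b)) = f w ^ p + a ^ p • f (pmap p F L b) := by
      rw [h, map_add, map_add, hf.map_derivedP z hz, add_zero, map_smul, hf.map_pmap w hw]
    rw [hfx, map_add, map_smul, map_add f₁, map_smul f₁, hf₁b, hf₁W w hw, add_pow_char,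
      _root_.smul_pow, hrt, map_pow]
    rfl
  · rw [eq_top_iff]
    have hof : ∀ r : R, alg r ∈ Algebra.adjoin F (f₁ '' ↑(W ⊔ Submodule.span F {b})) := by
      intro r
      have hr : alg r ∈ Subalgebra.map alg (Algebra.adjoin F (f '' W)) := by
        rw [hf.adjoin_eq]; exact ⟨r, trivial, rfl⟩
      rw [AlgHom.map_adjoin] at hr
      refine Algebra.adjoin_mono ?_ hr
      rintro _ ⟨_, ⟨w, hw, rfl⟩, rfl⟩
      exact ⟨w, le_sup_left (a := W) hw, hf₁W w hw⟩
    have hrtmem : rt ∈ Algebra.adjoin F (f₁ '' ↑(W ⊔ Submodule.span F {b})) :=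
      Algebra.subset_adjoin
        ⟨b, le_sup_right (a := W) (Submodule.mem_span_singleton_self b), hf₁b⟩
    rintro y -
    induction y using AdjoinRoot.induction_on with
    | ih q =>
      induction q using Polynomial.induction_on' with
      | add q₁ q₂ h₁ h₂ => rw [map_add]; exact add_mem h₁ h₂
      | monomial k r =>
        rw [← C_mul_X_pow_eq_monomial, map_mul, map_pow]
        exact mul_mem (hof r) (pow_mem hrtmem k)
  · exact Module.Finite.trans R R'
  · have hWb : Module.finrank F ↥(W ⊔ Submodule.span F {b}) = Module.finrank F W + 1 := by
      have hdis : W ⊓ Submodule.span F {b} = ⊥ :=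
        (Submodule.disjoint_span_singleton_of_notMem hb).eq_bot
      have hb0 : b ≠ 0 := fun h => hb (h ▸ W.zero_mem)
      have h := Submodule.finrank_sup_add_finrank_inf_eq W (Submodule.span F {b})
      rwa [hdis, finrank_bot, add_zero, finrank_span_singleton hb0] at h
    rw [hWb, pow_succ, ← hf.finrank_mul, ← Module.finrank_mul_finrank F R R', hfin]
    ring

variable (p F L) in
/-- `u(L)` has a commutative quotient of dimension `p ^ dim (L / L'_p)`. -/
lemma exists_commutative_quotient [CharP F p] [FiniteDimensional F L] (hL : IsPNilpotent p F L) :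
    ∃ (R : Type uF) (_ : CommRing R) (_ : Algebra F R) (g : uEnv p F L →ₐ[F] R),
      Function.Surjective g ∧ Module.Finite F R ∧
        Module.finrank F R = p ^ Module.finrank F (L ⧸ derivedP p F L) := by
  have hp : p.Prime := Fact.out
  let S : Set (Submodule F L) := {W | ∃ (R : Type uF) (_ : CommRing R) (_ : Algebra F R)
    (f : L →ₗ[F] R), IsAbelianEnvelope p W f}
  have hS : S.Nonempty := ⟨_, F, inferInstance, inferInstance, 0, isAbelianEnvelope_derivedP⟩
  obtain ⟨W, ⟨R, _, _, f, hf⟩, hmax⟩ := WellFounded.has_min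
    (wellFounded_gt (α := Submodule F L)) S hS
  have hW : W = ⊤ := by
    by_contra hne
    obtain ⟨s, hs⟩ := exists_iterate_pmap_eq_zero hL
    obtain ⟨x, hx⟩ : ∃ x, x ∉ W := by
      by_contra! h
      exact hne (eq_top_iff.2 fun x _ => h x)
    have hex : ∃ k, (pmap p F L)^[k] x ∈ W := ⟨s, by rw [hs]; exact W.zero_mem⟩
    classical
    obtain ⟨k, hk⟩ : ∃ k, Nat.find hex = k + 1 := Nat.exists_eq_succ_of_ne_zero fun h0 =>
      hx (by simpa [h0] using Nat.find_spec hex)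
    have hb : (pmap p F L)^[k] x ∉ W := Nat.find_min hex (by omega)
    have hbp : pmap p F L ((pmap p F L)^[k] x) ∈ W := by
      have := Nat.find_spec hex
      rwa [hk, Function.iterate_succ_apply'] at this
    refine hmax _ (hf.exists_succ hb hbp) ?_
    exact lt_of_le_of_ne le_sup_left fun h =>
      hb (h ▸ le_sup_right (a := W) (Submodule.mem_span_singleton_self _))
  subst hW
  obtain ⟨g, hg⟩ := exists_algHom_of_comm (p := p) f
    (fun x hx => hf.map_derivedP x (derivedSub_le_derivedP p F hx))
    (fun x => hf.map_pmap x trivial)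
  refine ⟨R, _, _, g, ?_, hf.finite, ?_⟩
  · rw [← AlgHom.range_eq_top, eq_top_iff, ← hf.adjoin_eq, Algebra.adjoin_le_iff]
    rintro _ ⟨x, -, rfl⟩
    exact ⟨_, hg x⟩
  · have h := hf.finrank_mul
    rw [finrank_top, ← (derivedP p F L).finrank_quotient_add_finrank, pow_add] at h
    exact Nat.eq_of_mul_eq_mul_right (pow_pos hp.pos _) h

end Tower

section Monomials

variable {n : ℕ} {B : Type*} [CommRing B]

/-- The monomial with exponent vector `c` in the elements `x i`. -/
def monom (x : Fin n → B) (c : Fin n → ℕ) : B := ∏ i, x i ^ c i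

lemma monom_add (x : Fin n → B) (c d : Fin n → ℕ) :
    monom x (c + d) = monom x c * monom x d := by
  simp [monom, pow_add, Finset.prod_mul_distrib]

lemma monom_smul (x : Fin n → B) (k : ℕ) (c : Fin n → ℕ) :
    monom x (k • c) = monom x c ^ k := by
  simp [monom, ← Finset.prod_pow, ← pow_mul, mul_comm]

lemma monom_single (x : Fin n → B) (i : Fin n) (k : ℕ) :
    monom x (Pi.single i k) = x i ^ k := by
  rw [monom, Finset.prod_eq_single i]
  · simp
  · intro j _ hj; simp [hj]
  · simp

lemma monom_zero (x : Fin n → B) : monom x 0 = 1 := by simp [monom]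

variable {p : ℕ} {ex : Fin n → ℕ}

/-- The exponent vector with base-`p` digits `a i j`. -/
def expo (a : (i : Fin n) → Fin (ex i) → Fin p) (i : Fin n) : ℕ := ∑ j, (a i j : ℕ) * p ^ (j : ℕ)

lemma expo_eq (a : (i : Fin n) → Fin (ex i) → Fin p) (i : Fin n) :
    expo a i = finFunctionFinEquiv (a i) := (finFunctionFinEquiv_apply _).symm

lemma expo_injective :
    Function.Injective (expo : ((i : Fin n) → Fin (ex i) → Fin p) → Fin n → ℕ) := by
  intro a b h
  funext i
  have hi := congrFun h i
  rw [expo_eq, expo_eq] at hi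
  exact finFunctionFinEquiv.injective (Fin.ext hi)

lemma expo_lt (a : (i : Fin n) → Fin (ex i) → Fin p) (i : Fin n) : expo a i < p ^ ex i := by
  rw [expo_eq]; exact Fin.isLt _

lemma exists_expo_eq {c : Fin n → ℕ} (hc : ∀ i, c i < p ^ ex i) :
    ∃ a : (i : Fin n) → Fin (ex i) → Fin p, expo a = c := by
  refine ⟨fun i => finFunctionFinEquiv.symm ⟨c i, hc i⟩, ?_⟩
  funext i
  rw [expo_eq]
  simp

/-- The digit vector with a single digit `1`. -/
def digitSingle (hp : 1 < p) (q : Σ i : Fin n, Fin (ex i)) : (i : Fin n) → Fin (ex i) → Fin p :=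
  fun i j => if (⟨i, j⟩ : Σ i : Fin n, Fin (ex i)) = q then ⟨1, hp⟩ else ⟨0, by omega⟩

lemma digitSingle_val (hp : 1 < p) (q : Σ i : Fin n, Fin (ex i)) (i : Fin n) (j : Fin (ex i)) :
    (digitSingle hp q i j : ℕ) = if (⟨i, j⟩ : Σ i : Fin n, Fin (ex i)) = q then 1 else 0 := by
  rw [digitSingle]; split_ifs <;> rfl

lemma digitSingle_injective (hp : 1 < p) :
    Function.Injective (digitSingle hp : (Σ i : Fin n, Fin (ex i)) → _) := by
  intro q r h
  have h1 := congrArg Fin.val (congrFun (congrFun h q.1) q.2)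
  rw [digitSingle_val, digitSingle_val, if_pos rfl] at h1
  by_contra hne
  rw [if_neg hne] at h1
  exact one_ne_zero h1

lemma expo_digitSingle (hp : 1 < p) (q : Σ i : Fin n, Fin (ex i)) :
    expo (digitSingle hp q) = Pi.single q.1 (p ^ (q.2 : ℕ)) := by
  obtain ⟨i, j⟩ := q
  funext k
  simp only [expo, digitSingle_val]
  by_cases hk : k = i
  · subst hk
    rw [Finset.sum_eq_single j]
    · simp
    · intro l _ hl; simp [hl]
    · simp
  · rw [Pi.single_eq_of_ne hk]
    exact Finset.sum_eq_zero fun l _ => by simp [hk]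

lemma sum_digitSingle (hp : 1 < p) (q : Σ i : Fin n, Fin (ex i)) :
    ∑ i, ∑ j, (digitSingle hp q i j : ℕ) = 1 := by
  rw [← Fintype.sum_sigma' (fun i j => (digitSingle hp q i j : ℕ))]
  simp [digitSingle_val]

/-- The exponent vectors of the iterated `p`-th powers of the generators. -/
def IsPurePower (p : ℕ) (c : Fin n → ℕ) : Prop := ∃ i j, c = Pi.single i (p ^ j)

lemma isPurePower_nsmul_iff (hp : p.Prime) (c : Fin n → ℕ) :
    IsPurePower p (p • c) ↔ IsPurePower p c := by
  constructor
  · rintro ⟨i, j, h⟩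
    have hi : p * c i = p ^ j := by simpa using congrFun h i
    obtain _ | j := j
    · have : p ∣ 1 := ⟨c i, by simpa using hi.symm⟩
      exact absurd (Nat.dvd_one.1 this) hp.one_lt.ne'
    · refine ⟨i, j, ?_⟩
      funext k
      apply Nat.eq_of_mul_eq_mul_left hp.pos
      have hk := congrFun h k
      simp only [Pi.smul_apply, smul_eq_mul] at hk
      rw [hk]
      by_cases hki : k = i
      · subst hki; simp [pow_succ']
      · simp [hki]
  · rintro ⟨i, j, rfl⟩
    refine ⟨i, j + 1, ?_⟩
    rw [← Pi.single_smul', smul_eq_mul, pow_succ']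

lemma not_isPurePower_expo (hp : 1 < p) {a : (i : Fin n) → Fin (ex i) → Fin p}
    (ha : 2 ≤ ∑ i, ∑ j, (a i j : ℕ)) : ¬ IsPurePower p (expo a) := by
  rintro ⟨i, j, h⟩
  have hlt : p ^ j < p ^ ex i := by simpa [h] using expo_lt a i
  have hj : j < ex i := (Nat.pow_lt_pow_iff_right hp).1 hlt
  have : a = digitSingle hp ⟨i, ⟨j, hj⟩⟩ := expo_injective (by rw [h, expo_digitSingle])
  rw [this, sum_digitSingle] at ha
  omega

variable {F : Type*} [Field F] [Algebra F B] {x : Fin n → B}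

lemma span_range_monom (hx : Algebra.adjoin F (Set.range x) = ⊤) :
    Submodule.span F (Set.range (monom x)) = ⊤ := by
  rw [eq_top_iff, ← Algebra.top_toSubmodule, ← hx, Algebra.adjoin_eq_span]
  refine Submodule.span_mono fun y hy => ?_
  induction hy using Submonoid.closure_induction with
  | mem y hy =>
    obtain ⟨i, rfl⟩ := hy
    exact ⟨Pi.single i 1, by rw [monom_single, pow_one]⟩
  | one => exact ⟨0, monom_zero x⟩
  | mul y z _ _ hy hz =>
    obtain ⟨c, rfl⟩ := hy
    obtain ⟨d, rfl⟩ := hz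
    exact ⟨c + d, monom_add x c d⟩

lemma monom_eq_zero_or (hx0 : ∀ i, x i ^ p ^ ex i = 0) (c : Fin n → ℕ) :
    monom x c = 0 ∨ ∃ a : (i : Fin n) → Fin (ex i) → Fin p, expo a = c := by
  by_cases hc : ∀ i, c i < p ^ ex i
  · exact Or.inr (exists_expo_eq hc)
  · push Not at hc
    obtain ⟨i, hi⟩ := hc
    exact Or.inl (Finset.prod_eq_zero (Finset.mem_univ i) (pow_eq_zero_of_le hi (hx0 i)))

lemma span_range_monom_expo (hx : Algebra.adjoin F (Set.range x) = ⊤)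
    (hx0 : ∀ i, x i ^ p ^ ex i = 0) :
    Submodule.span F
      (Set.range fun a : (i : Fin n) → Fin (ex i) → Fin p => monom x (expo a)) = ⊤ := by
  rw [eq_top_iff, ← span_range_monom hx, Submodule.span_le]
  rintro _ ⟨c, rfl⟩
  obtain h | ⟨a, rfl⟩ := monom_eq_zero_or hx0 c
  · rw [h]; exact Submodule.zero_mem _
  · exact Submodule.subset_span ⟨a, rfl⟩

lemma card_digits : Fintype.card ((i : Fin n) → Fin (ex i) → Fin p) = p ^ ∑ i, ex i := by
  simp [Finset.prod_pow_eq_pow_sum]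

lemma finrank_le_of_adjoin_eq_top (hx : Algebra.adjoin F (Set.range x) = ⊤)
    (hx0 : ∀ i, x i ^ p ^ ex i = 0) : Module.finrank F B ≤ p ^ ∑ i, ex i := by
  rw [← card_digits, ← finrank_top, ← span_range_monom_expo hx hx0]
  exact finrank_range_le_card _

lemma linearIndependent_monom_expo (hx : Algebra.adjoin F (Set.range x) = ⊤)
    (hx0 : ∀ i, x i ^ p ^ ex i = 0) (hdim : Module.finrank F B = p ^ ∑ i, ex i) :
    LinearIndependent F
      (fun a : (i : Fin n) → Fin (ex i) → Fin p => monom x (expo a)) :=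
  linearIndependent_of_top_le_span_of_card_eq_finrank (span_range_monom_expo hx hx0).ge
    (by rw [card_digits, hdim])

end Monomials

section Projection

variable {n : ℕ} {B : Type*} [CommRing B] {p : ℕ} {ex : Fin n → ℕ}
variable {F : Type*} [Field F] [Algebra F B] {x : Fin n → B}

open Classical in
/-- The projection onto the span of the iterated `p`-th powers of the generators along the other
monomials. -/
lemma exists_purePower_projection (hx : Algebra.adjoin F (Set.range x) = ⊤)
    (hx0 : ∀ i, x i ^ p ^ ex i = 0) (hdim : Module.finrank F B = p ^ ∑ i, ex i) :
    ∃ P : B →ₗ[F] B, ∀ c, P (monom x c) = if IsPurePower p c then monom x c else 0 := by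
  let b := Module.Basis.mk (linearIndependent_monom_expo hx hx0 hdim)
    (span_range_monom_expo hx hx0).ge
  refine ⟨b.constr F fun a => if IsPurePower p (expo a) then monom x (expo a) else 0, fun c => ?_⟩
  obtain h | ⟨a, rfl⟩ := monom_eq_zero_or hx0 c
  · simp [h]
  · have := b.constr_basis F (fun a => if IsPurePower p (expo a) then monom x (expo a) else 0) a
    rwa [Module.Basis.mk_apply] at this

variable (F p x) in
/-- The span of the `p ^ j`-th powers of the generators with `k ≤ j`. -/
def powerSpan (k : ℕ) : Submodule F B :=
  Submodule.span F {y | ∃ i j, k ≤ j ∧ y = x i ^ p ^ j}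

lemma pow_mem_powerSpan [ExpChar B p] {d : B} (hd : d ∈ powerSpan p F x 1) (j : ℕ) :
    d ^ p ^ j ∈ powerSpan p F x (j + 1) := by
  induction hd using Submodule.span_induction with
  | mem y hy =>
    obtain ⟨i, k, hk, rfl⟩ := hy
    exact Submodule.subset_span ⟨i, k + j, by omega, by rw [← pow_mul, ← pow_add]⟩
  | zero =>
    rw [zero_pow (pow_ne_zero _ (expChar_pos B p).ne')]
    exact Submodule.zero_mem _
  | add y z _ _ hy hz => rw [add_pow_expChar_pow]; exact Submodule.add_mem _ hy hz
  | smul a y _ hy => rw [smul_pow]; exact Submodule.smul_mem _ _ hy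

lemma mem_span_monom_of_mem_sq (hx : Algebra.adjoin F (Set.range x) = ⊤) {q : B}
    (hq : q ∈ Ideal.span (Set.range x) * Ideal.span (Set.range x)) :
    q ∈ Submodule.span F (monom x '' {c | 2 ≤ ∑ i, c i}) := by
  have htop : ∀ a q : B, q ∈ Submodule.span F (monom x '' {c | 2 ≤ ∑ i, c i}) →
      a * q ∈ Submodule.span F (monom x '' {c | 2 ≤ ∑ i, c i}) := by
    intro a q hq
    have ha : a ∈ Submodule.span F (Set.range (monom x)) := by
      rw [span_range_monom hx]; trivial
    have h := Submodule.mul_mem_mul ha hq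
    rw [Submodule.span_mul_span] at h
    refine Submodule.span_mono ?_ h
    rintro _ ⟨_, ⟨d, rfl⟩, _, ⟨c, hc, rfl⟩, rfl⟩
    refine ⟨d + c, ?_, monom_add x d c⟩
    simp only [Set.mem_ofPred_eq, Pi.add_apply, Finset.sum_add_distrib] at hc ⊢
    omega
  rw [Ideal.span_mul_span'] at hq
  induction hq using Submodule.span_induction with
  | mem y hy =>
    obtain ⟨_, ⟨i, rfl⟩, _, ⟨j, rfl⟩, rfl⟩ := hy
    refine Submodule.subset_span ⟨Pi.single i 1 + Pi.single j 1, ?_, ?_⟩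
    · simp [Finset.sum_add_distrib]
    · simp [monom_add, monom_single]
  | zero => exact Submodule.zero_mem _
  | add y z _ _ hy hz => exact Submodule.add_mem _ hy hz
  | smul a y _ hy => exact htop a y hy

lemma eq_zero_of_algebraMap_isNilpotent [Nontrivial B] {c : F}
    (hc : IsNilpotent (algebraMap F B c)) : c = 0 := by
  obtain ⟨k, hk⟩ := hc
  rw [← map_pow, map_eq_zero] at hk
  exact eq_zero_of_pow_eq_zero hk

lemma isNilpotent_of_mem_span (hx0 : ∀ i, x i ^ p ^ ex i = 0) {y : B}
    (hy : y ∈ Ideal.span (Set.range x)) : IsNilpotent y := by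
  have : Ideal.span (Set.range x) ≤ nilradical B := by
    rw [Ideal.span_le]
    rintro _ ⟨i, rfl⟩
    exact ⟨_, hx0 i⟩
  exact mem_nilradical.1 (this hy)

lemma exists_algebraMap_add_mem (hx : Algebra.adjoin F (Set.range x) = ⊤) (y : B) :
    ∃ c : F, y - algebraMap F B c ∈ Ideal.span (Set.range x) := by
  have hy : y ∈ Algebra.adjoin F (Set.range x) := by rw [hx]; trivial
  induction hy using Algebra.adjoin_induction with
  | mem y hy => exact ⟨0, by simpa using Ideal.subset_span hy⟩
  | algebraMap r => exact ⟨r, by simp⟩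
  | add y z _ _ hy hz =>
    obtain ⟨c, hc⟩ := hy
    obtain ⟨d, hd⟩ := hz
    refine ⟨c + d, ?_⟩
    convert add_mem hc hd using 1
    rw [map_add]; ring
  | mul y z _ _ hy hz =>
    obtain ⟨c, hc⟩ := hy
    obtain ⟨d, hd⟩ := hz
    refine ⟨c * d, ?_⟩
    convert add_mem (Ideal.mul_mem_left _ z hc) (Ideal.mul_mem_left _ (algebraMap F B c) hd)
      using 1
    rw [map_mul]; ring

variable {V : Submodule F B}

/-- A subspace of nilpotent generators lies in the augmentation ideal. -/
lemma le_span_of_isNilpotent (hx : Algebra.adjoin F (Set.range x) = ⊤)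
    (hx0 : ∀ i, x i ^ p ^ ex i = 0) (hVnil : ∀ v ∈ V, IsNilpotent v) {v : B} (hv : v ∈ V) :
    v ∈ Ideal.span (Set.range x) := by
  nontriviality B
  obtain ⟨c, hc⟩ := exists_algebraMap_add_mem hx v
  have hnil : IsNilpotent (algebraMap F B c) := by
    have h := (Commute.all _ _).isNilpotent_sub (hVnil v hv) (isNilpotent_of_mem_span hx0 hc)
    rwa [sub_sub_cancel] at h
  rwa [eq_zero_of_algebraMap_isNilpotent hnil, map_zero, sub_zero] at hc

lemma exists_sub_mem_sq (hx : Algebra.adjoin F (Set.range x) = ⊤)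
    (hx0 : ∀ i, x i ^ p ^ ex i = 0) (hVnil : ∀ v ∈ V, IsNilpotent v)
    (hV : Algebra.adjoin F (V : Set B) = ⊤) (i : Fin n) :
    ∃ v ∈ V, x i - v ∈ Ideal.span (Set.range x) * Ideal.span (Set.range x) := by
  nontriviality B
  set I := Ideal.span (Set.range x) with hI
  have hVI : ∀ v ∈ V, v ∈ I := fun v => le_span_of_isNilpotent hx hx0 hVnil
  have key : ∀ y : B, ∃ c : F, ∃ v ∈ V, y - algebraMap F B c - v ∈ I * I := by
    intro y
    have hy : y ∈ Algebra.adjoin F (V : Set B) := by rw [hV]; trivial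
    induction hy using Algebra.adjoin_induction with
    | mem y hy => exact ⟨0, y, hy, by simp⟩
    | algebraMap r => exact ⟨r, 0, V.zero_mem, by simp⟩
    | add y z _ _ hy hz =>
      obtain ⟨c, v, hv, hc⟩ := hy
      obtain ⟨d, w, hw, hd⟩ := hz
      refine ⟨c + d, v + w, V.add_mem hv hw, ?_⟩
      convert add_mem hc hd using 1
      rw [map_add]; ring
    | mul y z _ _ hy hz =>
      obtain ⟨c, v, hv, hc⟩ := hy
      obtain ⟨d, w, hw, hd⟩ := hz
      refine ⟨c * d, c • w + d • v, V.add_mem (V.smul_mem _ hw) (V.smul_mem _ hv), ?_⟩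
      convert add_mem (add_mem (Ideal.mul_mem_left _ z hc)
        (Ideal.mul_mem_left _ (algebraMap F B c + v) hd))
        (Ideal.mul_mem_mul (hVI v hv) (hVI w hw)) using 1
      rw [map_mul, Algebra.smul_def, Algebra.smul_def]; ring
  obtain ⟨c, v, hv, hc⟩ := key (x i)
  have hcI : algebraMap F B c ∈ I := by
    have h1 : x i - v ∈ I := sub_mem (Ideal.subset_span ⟨i, rfl⟩) (hVI v hv)
    convert sub_mem h1 (Ideal.mul_le_left hc) using 1
    ring
  rw [eq_zero_of_algebraMap_isNilpotent (isNilpotent_of_mem_span hx0 hcI), map_zero,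
    sub_zero] at hc
  exact ⟨v, hv, hc⟩

/-- In a truncated polynomial algebra, a `p`-closed generating subspace `V` of nilpotent elements,
of dimension at most that of the span of the iterated `p`-th powers of the variables, meets the
span of all the other nonconstant monomials trivially. -/
lemma eq_zero_of_mem_of_mem_span [hp : Fact p.Prime] [CharP F p]
    (hx : Algebra.adjoin F (Set.range x) = ⊤)
    (hx0 : ∀ i, x i ^ p ^ ex i = 0) (hdim : Module.finrank F B = p ^ ∑ i, ex i)
    (hV : Algebra.adjoin F (V : Set B) = ⊤) (hVnil : ∀ v ∈ V, IsNilpotent v)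
    (hVp : ∀ v ∈ V, v ^ p ∈ V) (hVdim : Module.finrank F V ≤ ∑ i, ex i)
    {v : B} (hv : v ∈ V)
    (hvE : v ∈ Submodule.span F ((fun a : (i : Fin n) → Fin (ex i) → Fin p => monom x (expo a)) ''
      {a | 2 ≤ ∑ i, ∑ j, (a i j : ℕ)})) : v = 0 := by
  classical
  have hp1 : 1 < p := hp.out.one_lt
  have hfin : Module.Finite F B :=
    Module.finite_of_finrank_pos (by rw [hdim]; exact pow_pos hp.out.pos _)
  have hnt : Nontrivial B :=
    Module.nontrivial_of_finrank_pos (R := F) (by rw [hdim]; exact pow_pos hp.out.pos _)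
  have hchar : CharP B p := charP_of_injective_algebraMap (algebraMap F B).injective p
  have hexp : ExpChar B p := ExpChar.prime hp.out
  obtain ⟨P, hP⟩ := exists_purePower_projection hx hx0 hdim
  have hPx : ∀ i j, P (x i ^ p ^ j) = x i ^ p ^ j := fun i j => by
    rw [← monom_single, hP, if_pos ⟨i, j, rfl⟩]
  have hPp : ∀ y, P (y ^ p) = P y ^ p := by
    intro y
    have hy : y ∈ Submodule.span F (Set.range (monom x)) := by
      rw [span_range_monom hx]; trivial
    induction hy using Submodule.span_induction with
    | mem y hy =>
      obtain ⟨c, rfl⟩ := hy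
      simp only [← monom_smul, hP, isPurePower_nsmul_iff hp.out]
      split_ifs
      · rw [monom_smul]
      · rw [zero_pow hp.out.ne_zero]
    | zero => rw [zero_pow hp.out.ne_zero, map_zero, zero_pow hp.out.ne_zero]
    | add y z _ _ hy hz => rw [add_pow_char, map_add, hy, hz, map_add, add_pow_char]
    | smul a y _ hy => rw [smul_pow, map_smul, hy, map_smul, smul_pow]
  have hPpow : ∀ k y, P (y ^ p ^ k) = P y ^ p ^ k := by
    intro k
    induction k with
    | zero => simp
    | succ k ih => intro y; rw [pow_succ, pow_mul, hPp, ih, ← pow_mul]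
  have hVpow : ∀ k, ∀ v ∈ V, v ^ p ^ k ∈ V := by
    intro k
    induction k with
    | zero => simp
    | succ k ih => intro v hv; rw [pow_succ, pow_mul]; exact hVp _ (ih v hv)
  have hPsq : ∀ q ∈ Ideal.span (Set.range x) * Ideal.span (Set.range x),
      P q ∈ powerSpan p F x 1 := by
    intro q hq
    have h := mem_span_monom_of_mem_sq hx hq
    refine (Submodule.span_le.2 ?_ : _ ≤ (powerSpan p F x 1).comap P) h
    rintro _ ⟨c, hc, rfl⟩
    simp only [Submodule.comap_coe, Set.mem_preimage, SetLike.mem_coe, hP]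
    split_ifs with hpure
    · obtain ⟨i, j, rfl⟩ := hpure
      refine Submodule.subset_span ⟨i, j, ?_, monom_single x i _⟩
      by_contra! hj
      obtain rfl : j = 0 := by omega
      simp at hc
    · exact Submodule.zero_mem _
  have hsurj : ∀ t k, ∑ i, ex i ≤ k + t → powerSpan p F x k ≤ V.map P := by
    intro t
    induction t with
    | zero =>
      intro k hk
      refine Submodule.span_le.2 ?_
      rintro _ ⟨i, j, hj, rfl⟩
      have : ex i ≤ j :=
        (Finset.single_le_sum (f := ex) (fun _ _ => Nat.zero_le _) (Finset.mem_univ i)).trans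
          (hk.trans hj)
      rw [pow_eq_zero_of_le (Nat.pow_le_pow_right hp.out.pos this) (hx0 i)]
      exact Submodule.zero_mem _
    | succ t ih =>
      intro k hk
      refine Submodule.span_le.2 ?_
      rintro _ ⟨i, j, hj, rfl⟩
      obtain ⟨v, hv, hq⟩ := exists_sub_mem_sq hx hx0 hVnil hV i
      have hxi : x i = P v + P (x i - v) := by
        rw [← map_add, add_sub_cancel]
        simpa using (hPx i 0).symm
      have : x i ^ p ^ j = P (v ^ p ^ j) + P (x i - v) ^ p ^ j := by
        rw [hPpow, ← add_pow_char_pow, ← hxi]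
      rw [this]
      refine Submodule.add_mem _ (Submodule.mem_map_of_mem (hVpow j v hv))
        (ih (j + 1) (by omega) (pow_mem_powerSpan (hPsq _ hq) j))
  have hrank : ∑ i, ex i ≤ Module.finrank F (V.map P) := by
    have hli := (linearIndependent_monom_expo hx hx0 hdim).comp _ (digitSingle_injective hp1)
    have h := finrank_span_eq_card hli
    rw [Fintype.card_sigma] at h
    simp only [Fintype.card_fin] at h
    rw [← h]
    refine Submodule.finrank_mono ((Submodule.span_le.2 ?_).trans
      (hsurj (∑ i, ex i) 0 (by omega)))
    rintro _ ⟨q, rfl⟩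
    refine Submodule.subset_span ⟨q.1, q.2, Nat.zero_le _, ?_⟩
    simp only [Function.comp_apply, expo_digitSingle, monom_single]
  have hker : LinearMap.ker (P.domRestrict V) = ⊥ := by
    have h := (P.domRestrict V).finrank_range_add_finrank_ker
    rw [LinearMap.range_domRestrict] at h
    exact Submodule.finrank_eq_zero.1 (by omega)
  have hPv : P v = 0 := by
    refine (Submodule.span_le.2 ?_ : _ ≤ LinearMap.ker P) hvE
    rintro _ ⟨a, ha, rfl⟩
    simp [hP, not_isPurePower_expo hp1 ha]
  have hmem : (⟨v, hv⟩ : V) ∈ LinearMap.ker (P.domRestrict V) := hPv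
  rw [hker, Submodule.mem_bot] at hmem
  exact congrArg Subtype.val hmem

end Projection

section Presentation

variable {p : ℕ} {F : Type*} [Field F]
variable {L : Type*} [LieRing L] [LieAlgebra F L] [RestrictedLieAlgebra p F L]
variable {n : ℕ} {e : Fin n → L} {ex : Fin n → ℕ} {X : (i : Fin n) → Fin (ex i) → L}
variable {B : Type*} [CommRing B] [Algebra F B]

lemma GoodPresentation.finrank_quotient (h : GoodPresentation p F L n e ex X) :
    Module.finrank F (L ⧸ derivedP p F L) = ∑ i, ex i := by
  rw [← finrank_top, ← h.2.1, finrank_span_eq_card h.1]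
  simp

variable [Fact p.Prime]

lemma GoodPresentation.pow_eq_zero (h : GoodPresentation p F L n e ex X)
    (g : uEnv p F L →ₐ[F] B) (i : Fin n) : g (uemb p F L (e i)) ^ p ^ ex i = 0 := by
  rw [← map_pow, ← uemb_iterate_pmap]
  exact map_uemb_eq_zero g (h.2.2.1 i)

lemma GoodPresentation.map_rep (h : GoodPresentation p F L n e ex X)
    (g : uEnv p F L →ₐ[F] B) (i : Fin n) (j : Fin (ex i)) :
    g (uemb p F L (X i j)) = g (uemb p F L (e i)) ^ p ^ (j : ℕ) := by
  rw [← map_pow, ← uemb_iterate_pmap, ← sub_eq_zero, ← map_sub, ← map_sub]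
  exact map_uemb_eq_zero g (h.2.2.2 i j)

lemma GoodPresentation.adjoin_eq_top (h : GoodPresentation p F L n e ex X)
    (g : uEnv p F L →ₐ[F] B) (hg : Function.Surjective g) :
    Algebra.adjoin F (Set.range fun i => g (uemb p F L (e i))) = ⊤ := by
  let f : (L ⧸ derivedP p F L) →ₗ[F] B :=
    (derivedP p F L).liftQ (g.toLinearMap.comp (uemb p F L)) fun x hx => map_uemb_eq_zero g hx
  have hf : LinearMap.range f ≤
      Subalgebra.toSubmodule (Algebra.adjoin F (Set.range fun i => g (uemb p F L (e i)))) := by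
    rw [LinearMap.range_eq_map, ← h.2.1, Submodule.map_span, Submodule.span_le]
    rintro _ ⟨_, ⟨q, rfl⟩, rfl⟩
    have : f (Submodule.Quotient.mk ((pmap p F L)^[(q.2 : ℕ)] (e q.1)))
        = g (uemb p F L (e q.1)) ^ p ^ (q.2 : ℕ) := by
      rw [← map_pow, ← uemb_iterate_pmap]; rfl
    rw [this]
    exact pow_mem (Algebra.subset_adjoin (Set.mem_range_self q.1)) _
  have hL : Algebra.adjoin F (g '' Set.range (uemb p F L)) = ⊤ := by
    rw [← AlgHom.map_adjoin, adjoin_range_uemb, Algebra.map_top, AlgHom.range_eq_top]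
    exact hg
  rw [eq_top_iff, ← hL, Algebra.adjoin_le_iff]
  rintro _ ⟨_, ⟨y, rfl⟩, rfl⟩
  exact hf ⟨Submodule.Quotient.mk y, rfl⟩

variable (p F) in
/-- The PBW monomial with exponents `a` in the representatives `X`. -/
noncomputable def pbwMonomial (X : (i : Fin n) → Fin (ex i) → L)
    (a : (i : Fin n) → Fin (ex i) → Fin p) : uEnv p F L :=
  ((List.finRange n).map (fun i =>
    ((List.finRange (ex i)).map (fun j => uemb p F L (X i j) ^ (a i j : ℕ))).prod)).prod

lemma GoodPresentation.map_pbwMonomial (h : GoodPresentation p F L n e ex X)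
    (g : uEnv p F L →ₐ[F] B) (a : (i : Fin n) → Fin (ex i) → Fin p) :
    g (pbwMonomial p F X a) = monom (fun i => g (uemb p F L (e i))) (expo a) := by
  simp only [pbwMonomial, map_list_prod, List.map_map, Function.comp_def, map_pow, h.map_rep]
  simp only [monom, expo, ← Finset.prod_pow_eq_pow_sum, ← List.ofFn_eq_map, List.prod_ofFn,
    ← pow_mul, mul_comm]

lemma eSpace_eq : eSpace p F L n ex X = jIdeal p F L ⊔
    Submodule.span F (pbwMonomial p F X '' {a | 2 ≤ ∑ i, ∑ j, (a i j : ℕ)}) := by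
  rw [eSpace]
  congr 2
  ext u
  constructor
  · rintro ⟨a, ha, hsum, rfl⟩
    exact ⟨fun i j => ⟨a i j, ha i j⟩, hsum, rfl⟩
  · rintro ⟨a, hsum, rfl⟩
    exact ⟨fun i j => a i j, fun i j => (a i j).isLt, hsum, rfl⟩

lemma finrank_range_map_uemb_le [FiniteDimensional F L] (g : uEnv p F L →ₐ[F] B) :
    Module.finrank F (LinearMap.range (g.toLinearMap.comp (uemb p F L)))
      ≤ Module.finrank F (L ⧸ derivedP p F L) := by
  rw [← Submodule.range_liftQ (derivedP p F L) (g.toLinearMap.comp (uemb p F L))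
    fun x hx => map_uemb_eq_zero g hx]
  exact LinearMap.finrank_range_le _

end Presentation

end RestrictedLieAlgebra

open RestrictedLieAlgebra in
/-- With `E ⊆ u(L)` as in the running setup and `φ : u(L) → u(H)` an algebra
isomorphism preserving augmentation ideals, one has `H ∩ φ(E) ⊆ J_H`. -/
theorem H_inter_phiE_le_J
    (p : ℕ) (F L H : Type*) [Field F] [Fact p.Prime] [CharP F p] [PerfectField F]
    [LieRing L] [LieAlgebra F L] [RestrictedLieAlgebra p F L]
    [LieRing H] [LieAlgebra F H] [RestrictedLieAlgebra p F H]
    [FiniteDimensional F L] [FiniteDimensional F H]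
    (hL : IsPNilpotent p F L) (hH : IsPNilpotent p F H)
    (n : ℕ) (e : Fin n → L) (ex : Fin n → ℕ) (X : (i : Fin n) → Fin (ex i) → L)
    (hpres : GoodPresentation p F L n e ex X)
    (φ : uEnv p F L ≃ₐ[F] uEnv p F H)
    (hω : (omegaIdeal p F L).map φ.toLinearMap = omegaIdeal p F H) :
    lSub p F H ⊓ (eSpace p F L n ex X).map φ.toLinearMap ≤ jIdeal p F H := by
  have hp : p.Prime := Fact.out
  obtain ⟨R, _, _, g, hg, -, hR⟩ := exists_commutative_quotient p F L hL
  obtain ⟨R', _, _, g', hg', -, hR'⟩ := exists_commutative_quotient p F H hH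
  rw [hpres.finrank_quotient] at hR
  have hdimH : Module.finrank F (H ⧸ derivedP p F H) ≤ ∑ i, ex i := by
    let k : uEnv p F L →ₐ[F] R' := g'.comp φ
    have hk : Function.Surjective k := hg'.comp φ.surjective
    have h := finrank_le_of_adjoin_eq_top (hpres.adjoin_eq_top k hk) (hpres.pow_eq_zero k)
    rw [hR'] at h
    exact (Nat.pow_le_pow_iff_right hp.one_lt).1 h
  let θ : uEnv p F H →ₐ[F] R := g.comp φ.symm
  have hθ : Function.Surjective θ := hg.comp φ.symm.surjective
  have hθφ : ∀ a, θ (φ a) = g a := fun a => congrArg g (φ.symm_apply_apply a)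
  let V := LinearMap.range (θ.toLinearMap.comp (uemb p F H))
  have hV : Algebra.adjoin F (V : Set R) = ⊤ := by
    have hVset : (V : Set R) = θ '' Set.range (uemb p F H) := by
      rw [← Set.range_comp]; rfl
    rw [hVset, ← AlgHom.map_adjoin, adjoin_range_uemb, Algebra.map_top, AlgHom.range_eq_top]
    exact hθ
  have hVnil : ∀ v ∈ V, IsNilpotent v := by
    rintro _ ⟨y, rfl⟩
    obtain ⟨s, hs⟩ := exists_iterate_pmap_eq_zero hH
    refine ⟨p ^ s, ?_⟩
    change θ (uemb p F H y) ^ p ^ s = 0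
    rw [← map_pow, ← uemb_iterate_pmap, hs, map_zero, map_zero]
  have hVp : ∀ v ∈ V, v ^ p ∈ V := by
    rintro _ ⟨y, rfl⟩
    refine ⟨pmap p F H y, ?_⟩
    change θ (uemb p F H (pmap p F H y)) = θ (uemb p F H y) ^ p
    rw [uemb_pmap, map_pow]
  rintro _ ⟨⟨y, rfl⟩, u, hu, huy⟩
  rw [SetLike.mem_coe, eSpace_eq] at hu
  obtain ⟨j, hj, m, hm, rfl⟩ := Submodule.mem_sup.1 hu
  have hJ : φ j ∈ jIdeal p F H := map_jIdeal_le φ hω (Submodule.mem_map_of_mem hj)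
  have huy' : uemb p F H y = φ j + φ m := by rw [← huy]; exact map_add φ j m
  have hθy : θ (uemb p F H y) = g m := by
    rw [huy', map_add, map_eq_zero_of_mem_jIdeal θ hJ, zero_add, hθφ]
  have hgm : g m = 0 := by
    rw [← hθy]
    refine eq_zero_of_mem_of_mem_span (hpres.adjoin_eq_top g hg) (hpres.pow_eq_zero g) hR hV hVnil
      hVp ((finrank_range_map_uemb_le θ).trans hdimH) ⟨y, rfl⟩ ?_
    rw [hθy]
    have h := Submodule.mem_map_of_mem (f := g.toLinearMap) hm
    rw [Submodule.map_span, Set.image_image] at h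
    simpa only [AlgHom.toLinearMap_apply, hpres.map_pbwMonomial] using h
  have hm0 : m = 0 := by
    have hli : LinearIndependent F (g.toLinearMap ∘ pbwMonomial p F X) := by
      convert linearIndependent_monom_expo (hpres.adjoin_eq_top g hg) (hpres.pow_eq_zero g) hR
        using 1
      funext a
      exact hpres.map_pbwMonomial g a
    exact Submodule.disjoint_def.1 (Submodule.range_ker_disjoint hli) m
      (Submodule.span_mono (Set.image_subset_range _ _) hm) hgm
  rw [huy', hm0, map_zero, add_zero]
  exact hJ
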